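/- arXiv:2408.05675 — 3 statements merged into one kernel-verified Lean document; each statement's English description precedes it below -/
import Mathlib

section
/- Let n ≥ 1 and let h : [0,∞) → [0,∞) be nondecreasing. If a > 0 and E ⊆ ℝⁿ is a measurable set with |E| = |B_a|, then ∫_{B_a} h(|x|) dx ≤ ∫_E h(|x|) dx. -/
open MeasureTheory Metric Set
open scoped ENNReal

/-- The bathtub principle: if `f ≤ c` on `s` and `c ≤ f` off `s`, then `s` minimizes the integral
of `f` among sets of the same finite measure. -/
theorem setLIntegral_le_of_le_of_ge {α : Type*} [MeasurableSpace α] {μ : Measure α}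
    {f : α → ℝ≥0∞} {c : ℝ≥0∞} {s t : Set α} (hs : MeasurableSet s) (ht : MeasurableSet t)
    (hst : μ t = μ s) (hfin : μ s ≠ ∞) (hle : ∀ x ∈ s, f x ≤ c) (hge : ∀ x ∉ s, c ≤ f x) :
    ∫⁻ x in s, f x ∂μ ≤ ∫⁻ x in t, f x ∂μ := by
  have hdiff : μ (s \ t) = μ (t \ s) := by
    have hs' := measure_inter_add_sdiff (μ := μ) s ht
    have ht' := measure_inter_add_sdiff (μ := μ) t hs
    rw [inter_comm, hst, ← hs'] at ht'
    exact ((ENNReal.add_right_inj (measure_ne_top_of_subset inter_subset_left hfin)).1 ht').symm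
  rw [← lintegral_inter_add_sdiff f s ht, ← lintegral_inter_add_sdiff f t hs, inter_comm t s]
  refine add_le_add le_rfl ?_
  calc ∫⁻ x in s \ t, f x ∂μ ≤ ∫⁻ _ in s \ t, c ∂μ :=
        setLIntegral_mono' (hs.diff ht) fun x hx => hle x hx.1
    _ = ∫⁻ _ in t \ s, c ∂μ := by rw [setLIntegral_const, setLIntegral_const, hdiff]
    _ ≤ ∫⁻ x in t \ s, f x ∂μ := setLIntegral_mono' (ht.diff hs) fun x hx => hge x hx.2

/-- Among sets of the volume of a centered ball, the centered ball minimizes the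
integral of a nondecreasing radial function. -/
theorem stmt_2 (n : ℕ) (hn : 1 ≤ n)
    (h : ℝ → ℝ) (hmono : MonotoneOn h (Set.Ici 0)) (hpos : ∀ t : ℝ, 0 ≤ t → 0 ≤ h t)
    (a : ℝ) (ha : 0 < a)
    (E : Set (EuclideanSpace ℝ (Fin n))) (hE : MeasurableSet E)
    (hvol : volume E = volume (ball (0 : EuclideanSpace ℝ (Fin n)) a)) :
    ∫⁻ x in ball (0 : EuclideanSpace ℝ (Fin n)) a, ENNReal.ofReal (h ‖x‖)
      ≤ ∫⁻ x in E, ENNReal.ofReal (h ‖x‖) := by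
  refine setLIntegral_le_of_le_of_ge (c := ENNReal.ofReal (h a)) measurableSet_ball hE hvol
    measure_ball_lt_top.ne (fun x hx => ?_) (fun x hx => ?_)
  · exact ENNReal.ofReal_le_ofReal
      (hmono (norm_nonneg x) ha.le (mem_ball_zero_iff.1 hx).le)
  · exact ENNReal.ofReal_le_ofReal
      (hmono ha.le (norm_nonneg x) (not_lt.1 fun hlt => hx (mem_ball_zero_iff.2 hlt)))
end

section
/- Let n ≥ 2, α ∈ (0,1), and let h : [0,∞) → [0,∞) be nondecreasing; set g(x) = h(|x|). Then for every a > 0 and every measurable set E ⊆ ℝⁿ with |E| = |B_a|, one has 𝓔(B_a) ≤ 𝓔(E); i.e., the centered ball minimizes the nonlocal free energy among sets of its volume. -/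
open MeasureTheory Metric Set
open scoped ENNReal

/-- The fractional (nonlocal) perimeter `P_α(E) = ∫_E ∫_{Eᶜ} |x-y|^{-(n+α)} dy dx`. -/
noncomputable def fracPerimeter (n : ℕ) (α : ℝ) (E : Set (EuclideanSpace ℝ (Fin n))) : ℝ≥0∞ :=
  ∫⁻ x in E, ∫⁻ y in Eᶜ, ENNReal.ofReal (‖x - y‖ ^ (-((n : ℝ) + α)))

/-- The nonlocal free energy `𝓔(E) = P_α(E) + ∫_E g`. -/
noncomputable def freeEnergy (n : ℕ) (α : ℝ) (g : EuclideanSpace ℝ (Fin n) → ℝ)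
    (E : Set (EuclideanSpace ℝ (Fin n))) : ℝ≥0∞ :=
  fracPerimeter n α E + ∫⁻ x in E, ENNReal.ofReal (g x)


section Polarization

open scoped RealInnerProductSpace

variable {V : Type*} [NormedAddCommGroup V] [InnerProductSpace ℝ V]

/-- For a unit vector `u`, the reflection in the hyperplane `{x | 2 * ⟪u, x⟫ = τ}`. -/
def mirror (u : V) (τ : ℝ) (x : V) : V := x + (τ - 2 * ⟪u, x⟫) • u

/-- The polarization (two-point symmetrization) of `E` towards the half-space
`{x | 2 * ⟪u, x⟫ ≤ τ}`. -/
def polarize (u : V) (τ : ℝ) (E : Set V) : Set V :=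
  {x | 2 * ⟪u, x⟫ ≤ τ ∧ (x ∈ E ∨ mirror u τ x ∈ E) ∨ x ∈ E ∧ mirror u τ x ∈ E}

variable {u : V} {τ : ℝ}

lemma inner_mirror (hu : ‖u‖ = 1) (x : V) : 2 * ⟪u, mirror u τ x⟫ = 2 * τ - 2 * ⟪u, x⟫ := by
  simp only [mirror, inner_add_right, inner_smul_right, real_inner_self_eq_norm_sq, hu]
  ring

lemma mirror_mirror (hu : ‖u‖ = 1) (x : V) : mirror u τ (mirror u τ x) = x := by
  have h := inner_mirror (τ := τ) hu x
  rw [mirror, h, mirror, add_assoc, ← add_smul, add_eq_left]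
  ring_nf
  exact zero_smul ℝ u

lemma mirror_eq_self {x : V} (h : 2 * ⟪u, x⟫ = τ) : mirror u τ x = x := by
  simp [mirror, h]

lemma norm_sq_sub_mirror (hu : ‖u‖ = 1) (x y : V) :
    ‖x - mirror u τ y‖ ^ 2 = ‖x - y‖ ^ 2 + (τ - 2 * ⟪u, x⟫) * (τ - 2 * ⟪u, y⟫) := by
  have h : x - mirror u τ y = (x - y) - (τ - 2 * ⟪u, y⟫) • u := by rw [mirror]; abel
  rw [h, norm_sub_sq_real, norm_smul, hu, inner_smul_right, ← real_inner_comm (x - y) u, inner_sub_right,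
    mul_one, Real.norm_eq_abs, sq_abs]
  ring

lemma norm_mirror_sub_mirror (hu : ‖u‖ = 1) (x y : V) :
    ‖mirror u τ x - mirror u τ y‖ = ‖x - y‖ := by
  rw [← sq_eq_sq₀ (norm_nonneg _) (norm_nonneg _), norm_sq_sub_mirror hu, norm_sub_rev,
    norm_sq_sub_mirror hu, inner_mirror hu, norm_sub_rev]
  ring

lemma norm_mirror_sub (hu : ‖u‖ = 1) (x y : V) :
    ‖mirror u τ x - y‖ = ‖x - mirror u τ y‖ := by
  rw [← norm_mirror_sub_mirror (τ := τ) hu (mirror u τ x) y, mirror_mirror hu]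

lemma norm_sq_mirror (hu : ‖u‖ = 1) (x : V) :
    ‖mirror u τ x‖ ^ 2 = ‖x‖ ^ 2 + τ * (τ - 2 * ⟪u, x⟫) := by
  have h := norm_sq_sub_mirror (τ := τ) hu 0 x
  simpa using h

lemma norm_le_norm_mirror (hu : ‖u‖ = 1) (hτ : 0 ≤ τ) {x : V} (hx : 2 * ⟪u, x⟫ ≤ τ) :
    ‖x‖ ≤ ‖mirror u τ x‖ := by
  rw [← sq_le_sq₀ (norm_nonneg _) (norm_nonneg _), norm_sq_mirror hu]
  nlinarith [mul_nonneg hτ (sub_nonneg.2 hx)]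

lemma mem_polarize_cases (hu : ‖u‖ = 1) (E : Set V) (x : V) :
    (2 * ⟪u, x⟫ ≤ τ ∧ (x ∈ polarize u τ E ↔ x ∈ E ∨ mirror u τ x ∈ E) ∧
        (mirror u τ x ∈ polarize u τ E ↔ x ∈ E ∧ mirror u τ x ∈ E)) ∨
      (τ ≤ 2 * ⟪u, x⟫ ∧ (x ∈ polarize u τ E ↔ x ∈ E ∧ mirror u τ x ∈ E) ∧
        (mirror u τ x ∈ polarize u τ E ↔ x ∈ E ∨ mirror u τ x ∈ E)) := by
  simp only [polarize, mem_ofPred_eq, mirror_mirror hu, inner_mirror hu]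
  rcases lt_trichotomy (2 * ⟪u, x⟫) τ with h | h | h
  · have h' : ¬ (2 * τ - 2 * ⟪u, x⟫ ≤ τ) := by linarith
    simp only [h.le, h', true_and, false_and, false_or]
    tauto
  · rw [mirror_eq_self h]
    simp [h.le]
  · have h' : 2 * τ - 2 * ⟪u, x⟫ ≤ τ := by linarith
    simp only [h.le, h.not_ge, h', true_and, false_and, false_or]
    tauto

lemma polarize_subset_ball (hu : ‖u‖ = 1) (hτ : 0 ≤ τ) {E : Set V} {R : ℝ}
    (hE : E ⊆ ball 0 R) : polarize u τ E ⊆ ball 0 R := by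
  rintro x (⟨hx, h | h⟩ | ⟨h, -⟩)
  · exact hE h
  · have := hE h
    rw [mem_ball_zero_iff] at this ⊢
    exact (norm_le_norm_mirror hu hτ hx).trans_lt this
  · exact hE h

lemma continuous_mirror_uncurry :
    Continuous fun q : V × sphere (0 : V) 1 × ℝ => mirror (q.2.1 : V) q.2.2 q.1 := by
  unfold mirror
  fun_prop

@[fun_prop]
lemma measurable_mirror [MeasurableSpace V] [BorelSpace V] : Measurable (mirror u τ) := by
  have : Continuous (mirror u τ) := by unfold mirror; fun_prop
  exact this.measurable

lemma measurableSet_polarize [MeasurableSpace V] [BorelSpace V] {E : Set V}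
    (hE : MeasurableSet E) : MeasurableSet (polarize u τ E) := by
  have h1 : MeasurableSet {x : V | 2 * ⟪u, x⟫ ≤ τ} := by
    have : Continuous fun x : V => 2 * ⟪u, x⟫ := by fun_prop
    exact (isClosed_le this continuous_const).measurableSet
  have h2 : MeasurableSet (mirror u τ ⁻¹' E) := measurable_mirror hE
  exact (h1.inter (hE.union h2)).union (hE.inter h2)

variable [FiniteDimensional ℝ V] [MeasurableSpace V] [BorelSpace V]

lemma measurePreserving_mirror (hu : ‖u‖ = 1) :
    MeasurePreserving (mirror u τ) (volume : Measure V) volume := by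
  have h1 := ((ℝ ∙ u)ᗮ.reflection).measurePreserving
  have h2 := measurePreserving_add_right (volume : Measure V) (τ • u)
  have h : mirror u τ = (· + τ • u) ∘ (ℝ ∙ u)ᗮ.reflection := by
    funext x
    simp only [mirror, Function.comp, Submodule.reflection_orthogonal_apply,
      Submodule.reflection_singleton_apply, hu]
    simp only [RCLike.ofReal_one, one_pow, div_one, sub_smul, mul_smul, two_smul]
    abel
  rw [h]
  exact h2.comp h1

lemma two_mul_lintegral_mirror (hu : ‖u‖ = 1) {f : V → ℝ≥0∞} (hf : Measurable f) :
    2 * ∫⁻ x, f x = ∫⁻ x, (f x + f (mirror u τ x)) := by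
  rw [lintegral_add_left hf, (measurePreserving_mirror hu).lintegral_comp hf, two_mul]

lemma two_mul_volume_mirror (hu : ‖u‖ = 1) {E : Set V} (hE : MeasurableSet E) :
    2 * volume E = ∫⁻ x, (E.indicator 1 x + E.indicator 1 (mirror u τ x)) := by
  rw [← two_mul_lintegral_mirror hu (measurable_one.indicator hE), lintegral_indicator_one hE]

lemma volume_polarize (hu : ‖u‖ = 1) {E : Set V} (hE : MeasurableSet E) :
    volume (polarize u τ E) = volume E := by
  have h : (2 : ℝ≥0∞) * volume (polarize u τ E) = 2 * volume E := by
    rw [two_mul_volume_mirror (τ := τ) hu hE,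
      two_mul_volume_mirror (τ := τ) hu (measurableSet_polarize hE)]
    congr 1 with x
    classical
    simp only [indicator_apply, Pi.one_apply]
    rcases mem_polarize_cases (τ := τ) hu E x with ⟨-, h1, h2⟩ | ⟨-, h1, h2⟩ <;>
      simp only [h1, h2] <;> by_cases a : x ∈ E <;> by_cases b : mirror u τ x ∈ E <;> simp [a, b]
  exact (ENNReal.mul_right_inj two_ne_zero ENNReal.ofNat_ne_top).1 h

/-- Polarization moves into the centered ball the part of `E` outside it which is
reflected into the ball minus `E`. -/
lemma volume_polarize_diff_ball_add (hu : ‖u‖ = 1) (hτ : 0 ≤ τ) {E : Set V}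
    (hE : MeasurableSet E) (a : ℝ) :
    volume (polarize u τ E \ ball 0 a) + volume ((ball 0 a \ E) ∩ mirror u τ ⁻¹' (E \ ball 0 a))
      ≤ volume (E \ ball 0 a) := by
  have hB : MeasurableSet (ball (0 : V) a) := measurableSet_ball
  have hP := measurableSet_polarize (u := u) (τ := τ) hE
  have hG : MeasurableSet ((ball 0 a \ E) ∩ mirror u τ ⁻¹' (E \ ball 0 a)) :=
    (hB.diff hE).inter (measurable_mirror (hE.diff hB))
  rw [← ENNReal.mul_le_mul_iff_right two_ne_zero ENNReal.ofNat_ne_top, mul_add,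
    two_mul_volume_mirror (τ := τ) hu (hE.diff hB), two_mul_volume_mirror (τ := τ) hu (hP.diff hB),
    two_mul_volume_mirror (τ := τ) hu hG, ← lintegral_add_left]
  · refine lintegral_mono fun x => ?_
    classical
    simp only [indicator_apply, Pi.one_apply, mem_sdiff, mem_inter_iff, mem_preimage,
      mirror_mirror hu]
    rcases mem_polarize_cases (τ := τ) hu E x with ⟨h, h1, h2⟩ | ⟨h, h1, h2⟩
    · have hm : mirror u τ x ∈ ball 0 a → x ∈ ball 0 a := fun hx => by
        rw [mem_ball_zero_iff] at hx ⊢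
        exact (norm_le_norm_mirror hu hτ h).trans_lt hx
      simp only [h1, h2]
      clear hG hP hB
      generalize ball (0 : V) a = B at hm ⊢
      by_cases a1 : x ∈ E <;> by_cases a2 : mirror u τ x ∈ E <;> by_cases a3 : x ∈ B <;>
        by_cases a4 : mirror u τ x ∈ B <;> simp_all
    · have hm : x ∈ ball 0 a → mirror u τ x ∈ ball 0 a := fun hx => by
        have := norm_le_norm_mirror (x := mirror u τ x) hu hτ (by rw [inner_mirror hu]; linarith)
        rw [mirror_mirror hu] at this
        rw [mem_ball_zero_iff] at hx ⊢
        exact this.trans_lt hx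
      simp only [h1, h2]
      clear hG hP hB
      generalize ball (0 : V) a = B at hm ⊢
      by_cases a1 : x ∈ E <;> by_cases a2 : mirror u τ x ∈ E <;> by_cases a3 : x ∈ B <;>
        by_cases a4 : mirror u τ x ∈ B <;> simp_all
  · exact ((measurable_one.indicator (hP.diff hB))).add
      ((measurable_one.indicator (hP.diff hB)).comp measurable_mirror)

/-- Polar coordinates around `x`, with the Jacobian bounded on a ball. -/
lemma volume_le_lintegral_sphere [Nontrivial V] {A : Set V} (hA : MeasurableSet A) {x : V} {ρ : ℝ}
    (hAρ : A ⊆ ball x ρ) :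
    volume A ≤ ENNReal.ofReal (ρ ^ (Module.finrank ℝ V - 1)) *
      ∫⁻ u : sphere (0 : V) 1, (∫⁻ r in Ioi (0 : ℝ), A.indicator 1 (x + r • (u : V)))
        ∂(volume : Measure V).toSphere := by
  set f : V → ℝ≥0∞ := fun z => A.indicator 1 (x + z) with hf
  have hfm : Measurable f := (measurable_one.indicator hA).comp (measurable_const_add x)
  have hbound : ∀ u : sphere (0 : V) 1, ∫⁻ r : Ioi (0 : ℝ), f ((r : ℝ) • (u : V))
      ∂Measure.volumeIoiPow (Module.finrank ℝ V - 1) ≤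
      ENNReal.ofReal (ρ ^ (Module.finrank ℝ V - 1)) *
        ∫⁻ r in Ioi (0 : ℝ), f (r • (u : V)) := by
    intro u
    have hfu : Measurable fun r : ℝ => f (r • (u : V)) :=
      hfm.comp (by fun_prop : Continuous fun r : ℝ => r • (u : V)).measurable
    have hsub : Measurable fun r : Ioi (0 : ℝ) => f ((r : ℝ) • (u : V)) :=
      hfu.comp measurable_subtype_coe
    rw [Measure.volumeIoiPow, lintegral_withDensity_eq_lintegral_mul _ (by fun_prop) hsub, ← lintegral_const_mul _ hfu]
    simp only [Pi.mul_apply]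
    rw [lintegral_subtype_comap measurableSet_Ioi fun r : ℝ =>
      ENNReal.ofReal (r ^ (Module.finrank ℝ V - 1)) * f (r • (u : V))]
    refine setLIntegral_mono' measurableSet_Ioi fun r (hr : 0 < r) => ?_
    by_cases h : x + r • (u : V) ∈ A
    · gcongr
      have := hAρ h
      rw [mem_ball_iff_norm, add_sub_cancel_left, norm_smul, norm_eq_of_mem_sphere,
        Real.norm_of_nonneg hr.le, mul_one] at this
      exact this.le
    · simp [hf, h]
  have hmap := (volume : Measure V).measurePreserving_homeomorphUnitSphereProd
  have hsymm := hmap.symm (homeomorphUnitSphereProd V).toMeasurableEquiv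
  have hfm' : Measurable fun z : ({0}ᶜ : Set V) => f z := hfm.comp measurable_subtype_coe
  calc volume A = ∫⁻ z, A.indicator 1 z := (lintegral_indicator_one hA).symm
    _ = ∫⁻ z, f z := (lintegral_add_left_eq_self _ x).symm
    _ = ∫⁻ z in ({0}ᶜ : Set V), f z := by rw [restrict_compl_singleton]
    _ = ∫⁻ z : ({0}ᶜ : Set V), f z ∂((volume : Measure V).comap (↑)) :=
      (lintegral_subtype_comap (measurableSet_singleton 0).compl f).symm
    _ = ∫⁻ p, f ((homeomorphUnitSphereProd V).symm p) ∂((volume : Measure V).toSphere.prod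
          (Measure.volumeIoiPow (Module.finrank ℝ V - 1))) :=
      (hsymm.lintegral_comp hfm').symm
    _ = ∫⁻ u : sphere (0 : V) 1, (∫⁻ r : Ioi (0 : ℝ), f ((r : ℝ) • (u : V))
          ∂Measure.volumeIoiPow (Module.finrank ℝ V - 1)) ∂(volume : Measure V).toSphere := by
      rw [lintegral_prod]
      · simp
      · exact (hfm'.comp (homeomorphUnitSphereProd V).symm.measurable).aemeasurable
    _ ≤ ∫⁻ u : sphere (0 : V) 1, ENNReal.ofReal (ρ ^ (Module.finrank ℝ V - 1)) *
          (∫⁻ r in Ioi (0 : ℝ), f (r • (u : V))) ∂(volume : Measure V).toSphere :=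
      lintegral_mono hbound
    _ = _ := by rw [lintegral_const_mul' _ _ ENNReal.ofReal_ne_top]

/-- Averaging over all reflections: if no polarization moves much mass of `E` into the ball,
then `E` is close to the ball. -/
lemma volume_mul_volume_le_of_forall_mirror [Nontrivial V] {E : Set V} (hE : MeasurableSet E)
    {a R : ℝ} (hER : E ⊆ ball 0 R) {m : ℝ≥0∞}
    (hm : ∀ (u : V) (τ : ℝ), ‖u‖ = 1 → 0 ≤ τ →
      volume ((ball 0 a \ E) ∩ mirror u τ ⁻¹' (E \ ball 0 a)) ≤ m) :
    volume (E \ ball 0 a) * volume (ball 0 a \ E) ≤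
      m * (ENNReal.ofReal ((2 * R) ^ (Module.finrank ℝ V - 1)) *
        (volume : Measure V).toSphere univ * ENNReal.ofReal (2 * R)) := by
  set A := E \ ball 0 a with hAdef
  set C := ball 0 a \ E with hCdef
  have hA : MeasurableSet A := hE.diff measurableSet_ball
  have hC : MeasurableSet C := measurableSet_ball.diff hE
  set c := ENNReal.ofReal ((2 * R) ^ (Module.finrank ℝ V - 1))
  set ν := (volume : Measure V).toSphere
  set I : Measure ℝ := volume.restrict (Ioc 0 (2 * R))
  have hmeas : Measurable fun q : V × sphere (0 : V) 1 × ℝ =>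
      A.indicator (1 : V → ℝ≥0∞) (mirror (q.2.1 : V) q.2.2 q.1) :=
    (measurable_one.indicator hA).comp continuous_mirror_uncurry.measurable
  have hline : ∀ x ∈ C, ∀ u : sphere (0 : V) 1,
      ∫⁻ r in Ioi (0 : ℝ), A.indicator (1 : V → ℝ≥0∞) (x + r • (u : V)) ≤
        ∫⁻ τ, A.indicator (1 : V → ℝ≥0∞) (mirror (u : V) τ x) ∂I := by
    intro x hx u
    have hu : ‖(u : V)‖ = 1 := norm_eq_of_mem_sphere u
    rw [← lintegral_indicator measurableSet_Ioi, ← lintegral_indicator measurableSet_Ioc,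
      ← lintegral_sub_right_eq_self _ (2 * ⟪(u : V), x⟫)]
    refine lintegral_mono fun τ => ?_
    by_cases h1 : τ - 2 * ⟪(u : V), x⟫ ∈ Ioi (0 : ℝ)
    · by_cases h2 : mirror (u : V) τ x ∈ A
      · have hxa : ‖x‖ < a := mem_ball_zero_iff.1 hx.1
        have hya : a ≤ ‖mirror (u : V) τ x‖ := by simpa using h2.2
        have hyR : ‖mirror (u : V) τ x‖ < R := mem_ball_zero_iff.1 (hER h2.1)
        have hsq := norm_sq_mirror (τ := τ) hu x
        have h1' : 0 < τ - 2 * ⟪(u : V), x⟫ := h1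
        have hτ : τ ∈ Ioc 0 (2 * R) := by
          constructor
          · by_contra! hneg
            nlinarith [norm_nonneg x, mul_nonneg (sub_nonneg.2 hneg) h1'.le]
          · have e1 := inner_mirror (τ := τ) hu x
            have e2 := real_inner_le_norm (u : V) x
            have e3 := real_inner_le_norm (u : V) (mirror (u : V) τ x)
            rw [hu, one_mul] at e2 e3
            linarith
        rw [indicator_of_mem hτ, indicator_of_mem h1]
        rfl
      · rw [indicator_of_mem h1]
        change A.indicator 1 (mirror (u : V) τ x) ≤ _
        rw [indicator_of_notMem h2]
        exact zero_le
    · rw [indicator_of_notMem h1]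
      exact zero_le
  have hpoint : ∀ x ∈ C, volume A ≤
      c * ∫⁻ p, A.indicator (1 : V → ℝ≥0∞) (mirror (p.1 : V) p.2 x) ∂(ν.prod I) := by
    intro x hx
    have hsub : A ⊆ ball x (2 * R) := by
      intro y hy
      have hxa : ‖x‖ < a := mem_ball_zero_iff.1 hx.1
      have hya : a ≤ ‖y‖ := by simpa using hy.2
      have hyR : ‖y‖ < R := mem_ball_zero_iff.1 (hER hy.1)
      rw [mem_ball_iff_norm]
      linarith [norm_sub_le y x]
    refine (volume_le_lintegral_sphere hA hsub).trans ?_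
    have hx' : Measurable fun p : sphere (0 : V) 1 × ℝ =>
        A.indicator (1 : V → ℝ≥0∞) (mirror (p.1 : V) p.2 x) := hmeas.comp measurable_prodMk_left
    rw [lintegral_prod _ hx'.aemeasurable]
    exact mul_le_mul_right (lintegral_mono fun u => hline x hx u) _
  calc volume A * volume C = ∫⁻ _ in C, volume A := by rw [setLIntegral_const]
    _ ≤ ∫⁻ x in C, c * ∫⁻ p, A.indicator (1 : V → ℝ≥0∞) (mirror (p.1 : V) p.2 x) ∂(ν.prod I) :=
      setLIntegral_mono' hC hpoint
    _ = c * ∫⁻ x in C, ∫⁻ p, A.indicator (1 : V → ℝ≥0∞) (mirror (p.1 : V) p.2 x) ∂(ν.prod I) :=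
      lintegral_const_mul' _ _ ENNReal.ofReal_ne_top
    _ = c * ∫⁻ p, (∫⁻ x in C, A.indicator (1 : V → ℝ≥0∞) (mirror (p.1 : V) p.2 x)) ∂(ν.prod I) := by
      rw [lintegral_lintegral_swap hmeas.aemeasurable]
    _ ≤ c * ∫⁻ _, m ∂(ν.prod I) := by
      gcongr 1
      have hae : ∀ᵐ p ∂(ν.prod I), p.2 ∈ Ioc 0 (2 * R) :=
        Measure.quasiMeasurePreserving_snd.ae (ae_restrict_mem measurableSet_Ioc)
      refine lintegral_mono_ae (hae.mono fun p hp => ?_)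
      refine le_trans (le_of_eq ?_) (hm p.1 p.2 (norm_eq_of_mem_sphere p.1) hp.1.le)
      rw [inter_comm, ← Measure.restrict_apply (measurable_mirror hA),
        ← lintegral_indicator_one (measurable_mirror hA)]
      rfl
    _ = m * (c * ν univ * ENNReal.ofReal (2 * R)) := by
      rw [lintegral_const, ← univ_prod_univ, Measure.prod_prod, Measure.restrict_apply_univ,
        Real.volume_Ioc, sub_zero]
      ring

/-- The self-interaction energy of `E` with radial kernel `k`. -/
noncomputable def interaction (k : ℝ → ℝ≥0∞) (E : Set V) : ℝ≥0∞ :=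
  ∫⁻ x in E, ∫⁻ y in E, k ‖x - y‖

lemma interaction_eq_lintegral (k : ℝ → ℝ≥0∞) {E : Set V} (hE : MeasurableSet E) :
    interaction k E = ∫⁻ x, ∫⁻ y, E.indicator 1 x * E.indicator 1 y * k ‖x - y‖ := by
  rw [interaction, ← lintegral_indicator hE]
  congr 1 with x
  by_cases hx : x ∈ E
  · rw [indicator_of_mem hx, ← lintegral_indicator hE]
    congr 1 with y
    by_cases hy : y ∈ E <;> simp [hx, hy]
  · simp [hx]

/-- Symmetrizing the self-interaction under a reflection in both variables. -/
lemma four_mul_interaction (hu : ‖u‖ = 1) {k : ℝ → ℝ≥0∞} (hk : Measurable k) {E : Set V}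
    (hE : MeasurableSet E) :
    2 * (2 * interaction k E) = ∫⁻ x, ∫⁻ y,
      ((E.indicator 1 x * E.indicator 1 y +
          E.indicator 1 (mirror u τ x) * E.indicator 1 (mirror u τ y)) * k ‖x - y‖ +
        (E.indicator 1 x * E.indicator 1 (mirror u τ y) +
          E.indicator 1 (mirror u τ x) * E.indicator 1 y) * k ‖x - mirror u τ y‖) := by
  have he : Measurable (E.indicator (1 : V → ℝ≥0∞)) := measurable_one.indicator hE
  have hF : Measurable fun p : V × V =>
      E.indicator (1 : V → ℝ≥0∞) p.1 * E.indicator 1 p.2 * k ‖p.1 - p.2‖ := by fun_prop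
  have hF1 : Measurable fun x : V => ∫⁻ y,
      E.indicator (1 : V → ℝ≥0∞) x * E.indicator 1 y * k ‖x - y‖ := hF.lintegral_prod_right'
  rw [interaction_eq_lintegral k hE, two_mul_lintegral_mirror (τ := τ) hu hF1,
    ← lintegral_const_mul' _ _ ENNReal.ofNat_ne_top]
  congr 1 with x
  rw [← lintegral_add_left (by fun_prop), two_mul_lintegral_mirror (τ := τ) hu (by fun_prop)]
  congr 1 with y
  rw [norm_mirror_sub_mirror hu, norm_mirror_sub hu]
  ring

lemma interaction_le_polarize (hu : ‖u‖ = 1) {k : ℝ → ℝ≥0∞} (hk : Measurable k)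
    (hanti : AntitoneOn k (Ici 0)) {E : Set V} (hE : MeasurableSet E) :
    interaction k E ≤ interaction k (polarize u τ E) := by
  rw [← ENNReal.mul_le_mul_iff_right two_ne_zero ENNReal.ofNat_ne_top,
    ← ENNReal.mul_le_mul_iff_right two_ne_zero ENNReal.ofNat_ne_top,
    four_mul_interaction (τ := τ) hu hk hE,
    four_mul_interaction (τ := τ) hu hk (measurableSet_polarize hE)]
  refine lintegral_mono fun x => lintegral_mono fun y => ?_
  have hk' : ∀ {v w : V}, ‖v‖ ^ 2 ≤ ‖w‖ ^ 2 → k ‖w‖ ≤ k ‖v‖ := fun h =>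
    hanti (norm_nonneg _) (norm_nonneg _) (by rwa [sq_le_sq₀ (norm_nonneg _) (norm_nonneg _)] at h)
  have hsq := norm_sq_sub_mirror (τ := τ) hu x y
  classical
  simp only [indicator_apply, Pi.one_apply]
  rcases mem_polarize_cases (τ := τ) hu E x with ⟨h, h1, h2⟩ | ⟨h, h1, h2⟩ <;>
    rcases mem_polarize_cases (τ := τ) hu E y with ⟨h', h3, h4⟩ | ⟨h', h3, h4⟩ <;>
    simp only [h1, h2, h3, h4]
  on_goal 1 => have hle : k ‖x - mirror u τ y‖ ≤ k ‖x - y‖ := hk' (by nlinarith)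
  on_goal 2 => have hle : k ‖x - y‖ ≤ k ‖x - mirror u τ y‖ := hk' (by nlinarith)
  on_goal 3 => have hle : k ‖x - y‖ ≤ k ‖x - mirror u τ y‖ := hk' (by nlinarith)
  on_goal 4 => have hle : k ‖x - mirror u τ y‖ ≤ k ‖x - y‖ := hk' (by nlinarith)
  all_goals
    clear hsq hk' h1 h2 h3 h4
    generalize k ‖x - mirror u τ y‖ = q at hle ⊢
    generalize k ‖x - y‖ = p at hle ⊢
    by_cases a1 : x ∈ E <;> by_cases a2 : mirror u τ x ∈ E <;> by_cases a3 : y ∈ E <;>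
      by_cases a4 : mirror u τ y ∈ E <;> simp [a1, a2, a3, a4, hle, add_comm]

lemma setLIntegral_kernel_le (k : ℝ → ℝ≥0∞) (x : V) (F : Set V) :
    ∫⁻ y in F, k ‖x - y‖ ≤ ∫⁻ y : V, k ‖y‖ :=
  (setLIntegral_le_lintegral F _).trans
    (lintegral_sub_left_eq_self (μ := (volume : Measure V)) (fun y => k ‖y‖) x).le

lemma interaction_le_add {k : ℝ → ℝ≥0∞} (hk : Measurable k) (E F : Set V) :
    interaction k E ≤ interaction k F + 2 * ((∫⁻ y : V, k ‖y‖) * volume (E \ F)) := by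
  set κ := ∫⁻ y : V, k ‖y‖
  have hsub : E ⊆ F ∪ E \ F := fun x hx => by by_cases h : x ∈ F <;> simp [h, hx]
  have hmeas : Measurable fun p : V × V => k ‖p.1 - p.2‖ := by fun_prop
  have hmeasF : Measurable fun x : V => ∫⁻ y in F, k ‖x - y‖ := hmeas.lintegral_prod_right'
  have hinner : ∀ G H : Set V, ∫⁻ x in G, ∫⁻ y in H, k ‖x - y‖ ≤ κ * volume G := fun G H =>
    (lintegral_mono fun x => setLIntegral_kernel_le k x H).trans (setLIntegral_const G κ).le
  calc interaction k E ≤ ∫⁻ x in F ∪ E \ F, ∫⁻ y in E, k ‖x - y‖ := lintegral_mono_set hsub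
    _ ≤ (∫⁻ x in F, ∫⁻ y in E, k ‖x - y‖) + ∫⁻ x in E \ F, ∫⁻ y in E, k ‖x - y‖ :=
      lintegral_union_le _ _ _
    _ ≤ (∫⁻ x in F, ((∫⁻ y in F, k ‖x - y‖) + ∫⁻ y in E \ F, k ‖x - y‖)) +
          κ * volume (E \ F) := by
      refine add_le_add (lintegral_mono fun x => ?_) (hinner _ _)
      exact (lintegral_mono_set hsub).trans (lintegral_union_le _ _ _)
    _ = interaction k F + (∫⁻ y in E \ F, ∫⁻ x in F, k ‖x - y‖) + κ * volume (E \ F) := by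
      rw [lintegral_add_left hmeasF, interaction]
      congr 2
      exact lintegral_lintegral_swap hmeas.aemeasurable
    _ ≤ interaction k F + κ * volume (E \ F) + κ * volume (E \ F) := by
      gcongr
      simpa only [norm_sub_rev] using hinner (E \ F) F
    _ = _ := by ring

/-- Riesz rearrangement for bounded sets: the ball maximizes the self-interaction. -/
lemma interaction_le_ball_of_bounded [Nontrivial V] {k : ℝ → ℝ≥0∞} (hk : Measurable k)
    (hanti : AntitoneOn k (Ici 0)) (hκ : ∫⁻ y : V, k ‖y‖ ≠ ∞) {E : Set V} (hE : MeasurableSet E)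
    {a R : ℝ} (hER : E ⊆ ball 0 R) (hvol : volume E ≤ volume (ball (0 : V) a)) :
    interaction k E ≤ interaction k (ball (0 : V) a) := by
  set P : Set (Set V) := {F | MeasurableSet F ∧ F ⊆ ball 0 R ∧ volume F ≤ volume (ball (0 : V) a) ∧
    interaction k E ≤ interaction k F}
  set δ : ℝ≥0∞ := ⨅ F ∈ P, volume (F \ ball 0 a)
  have hEP : E ∈ P := ⟨hE, hER, hvol, le_rfl⟩
  have hball : volume (ball (0 : V) a) ≠ ∞ := measure_ball_lt_top.ne
  have hfin : ∀ F ∈ P, volume (F \ ball 0 a) ≠ ∞ := fun F hF =>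
    ((measure_mono sdiff_subset).trans_lt (hF.2.2.1.trans_lt measure_ball_lt_top)).ne
  have hδ_le : ∀ F ∈ P, δ ≤ volume (F \ ball 0 a) := fun F hF => iInf₂_le F hF
  have hδ_top : δ ≠ ∞ := ne_top_of_le_ne_top (hfin E hEP) (hδ_le E hEP)
  have hexists : ∀ ε : ℝ≥0∞, ε ≠ 0 → ∃ F ∈ P, volume (F \ ball 0 a) < δ + ε := fun ε hε => by
    have : δ < δ + ε := ENNReal.lt_add_right hδ_top hε
    simpa only [δ, iInf_lt_iff, exists_prop] using this
  have hδ : δ = 0 := by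
    by_contra hδ0
    set D := ENNReal.ofReal ((2 * R) ^ (Module.finrank ℝ V - 1)) *
        (volume : Measure V).toSphere univ * ENNReal.ofReal (2 * R)
    have hD : D ≠ ∞ := ENNReal.mul_ne_top (ENNReal.mul_ne_top ENNReal.ofReal_ne_top
      (measure_ne_top _ _)) ENNReal.ofReal_ne_top
    obtain ⟨ε, hε0, hε⟩ := ENNReal.exists_nnreal_pos_mul_lt hD (mul_ne_zero hδ0 hδ0)
    obtain ⟨F, hF, hFδ⟩ := hexists ε (by exact_mod_cast hε0.ne')
    have hm : ∀ (u : V) (τ : ℝ), ‖u‖ = 1 → 0 ≤ τ →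
        volume ((ball 0 a \ F) ∩ mirror u τ ⁻¹' (F \ ball 0 a)) ≤ ε := by
      intro u τ hu hτ
      have hpol : polarize u τ F ∈ P :=
        ⟨measurableSet_polarize hF.1, polarize_subset_ball hu hτ hF.2.1,
          (volume_polarize hu hF.1).trans_le hF.2.2.1,
          hF.2.2.2.trans (interaction_le_polarize hu hk hanti hF.1)⟩
      refine (ENNReal.add_le_add_iff_left hδ_top).1 ?_
      calc _ ≤ _ := add_le_add_left (hδ_le _ hpol) _
        _ ≤ _ := volume_polarize_diff_ball_add hu hτ hF.1 a
        _ ≤ _ := hFδ.le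
    have hle : volume (F \ ball 0 a) ≤ volume (ball 0 a \ F) := by
      have h1 := measure_inter_add_sdiff (μ := volume) F (measurableSet_ball (x := (0 : V)) (ε := a))
      have h2 := measure_inter_add_sdiff (μ := volume) (ball (0 : V) a) hF.1
      have h3 := hF.2.2.1
      rw [← h1, ← h2, inter_comm] at h3
      exact (ENNReal.add_le_add_iff_left
        (ne_top_of_le_ne_top hball (measure_mono inter_subset_left))).1 h3
    refine hε.not_ge ?_
    calc δ * δ ≤ volume (F \ ball 0 a) * volume (ball 0 a \ F) :=
          mul_le_mul' (hδ_le F hF) ((hδ_le F hF).trans hle)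
      _ ≤ ε * D := volume_mul_volume_le_of_forall_mirror hF.1 hF.2.1 hm
  refine ENNReal.le_of_forall_pos_le_add fun η hη _ => ?_
  have h2κ : 2 * ∫⁻ y : V, k ‖y‖ ≠ ∞ := ENNReal.mul_ne_top ENNReal.ofNat_ne_top hκ
  obtain ⟨ε, hε0, hε⟩ := ENNReal.exists_nnreal_pos_mul_lt h2κ
    (by exact_mod_cast hη.ne' : (η : ℝ≥0∞) ≠ 0)
  obtain ⟨F, hF, hFδ⟩ := hexists ε (by exact_mod_cast hε0.ne')
  rw [hδ, zero_add] at hFδ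
  calc interaction k E ≤ interaction k F := hF.2.2.2
    _ ≤ interaction k (ball (0 : V) a) + 2 * ((∫⁻ y : V, k ‖y‖) * volume (F \ ball 0 a)) :=
      interaction_le_add hk _ _
    _ ≤ interaction k (ball (0 : V) a) + η := by
      gcongr
      rw [← mul_assoc]
      exact (mul_le_mul_right hFδ.le _).trans (by rw [mul_comm]; exact hε.le)

/-- Riesz rearrangement: the ball maximizes the self-interaction among sets of given volume. -/
lemma interaction_le_ball [Nontrivial V] {k : ℝ → ℝ≥0∞} (hk : Measurable k)
    (hanti : AntitoneOn k (Ici 0)) (hκ : ∫⁻ y : V, k ‖y‖ ≠ ∞) {E : Set V} (hE : MeasurableSet E)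
    {a : ℝ} (hvol : volume E ≤ volume (ball (0 : V) a)) :
    interaction k E ≤ interaction k (ball (0 : V) a) := by
  have hfin : volume E ≠ ∞ := (hvol.trans_lt measure_ball_lt_top).ne
  have htend : Filter.Tendsto (fun N : ℕ => volume (E \ ball 0 (N : ℝ))) Filter.atTop (nhds 0) := by
    have h := tendsto_measure_iInter_atTop (μ := volume) (s := fun N : ℕ => E \ ball (0 : V) N)
      (fun N => (hE.diff measurableSet_ball).nullMeasurableSet)
      (fun M N hMN => sdiff_subset_sdiff_right (ball_subset_ball (by exact_mod_cast hMN)))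
      ⟨0, ne_top_of_le_ne_top hfin (measure_mono sdiff_subset)⟩
    rwa [← sdiff_iUnion, iUnion_ball_nat, sdiff_univ, measure_empty] at h
  have hlim : Filter.Tendsto (fun N : ℕ => interaction k (ball (0 : V) a) +
      2 * ((∫⁻ y : V, k ‖y‖) * volume (E \ ball 0 (N : ℝ)))) Filter.atTop
      (nhds (interaction k (ball (0 : V) a) + 2 * ((∫⁻ y : V, k ‖y‖) * 0))) :=
    tendsto_const_nhds.add (ENNReal.Tendsto.const_mul
      (ENNReal.Tendsto.const_mul htend (Or.inr hκ)) (Or.inr ENNReal.ofNat_ne_top))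
  rw [mul_zero, mul_zero, add_zero] at hlim
  refine ge_of_tendsto' hlim fun N => ?_
  have h1 := interaction_le_add hk E (E ∩ ball 0 (N : ℝ))
  rw [sdiff_self_inter] at h1
  refine h1.trans ?_
  gcongr
  exact interaction_le_ball_of_bounded hk hanti hκ (hE.inter measurableSet_ball) inter_subset_right
    ((measure_mono inter_subset_left).trans hvol)

/-- For an integrable radially nonincreasing kernel, the ball minimizes the interaction with the
complement. -/
lemma lintegral_ball_compl_le [Nontrivial V] {k : ℝ → ℝ≥0∞} (hk : Measurable k)
    (hanti : AntitoneOn k (Ici 0)) (hκ : ∫⁻ y : V, k ‖y‖ ≠ ∞) {E : Set V} (hE : MeasurableSet E)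
    {a : ℝ} (hvol : volume E = volume (ball (0 : V) a)) :
    ∫⁻ x in ball (0 : V) a, ∫⁻ y in (ball (0 : V) a)ᶜ, k ‖x - y‖ ≤
      ∫⁻ x in E, ∫⁻ y in Eᶜ, k ‖x - y‖ := by
  have htotal : ∀ F : Set V, MeasurableSet F →
      interaction k F + ∫⁻ x in F, ∫⁻ y in Fᶜ, k ‖x - y‖ = (∫⁻ y : V, k ‖y‖) * volume F := by
    intro F hF
    have hmeas : Measurable fun p : V × V => k ‖p.1 - p.2‖ := by fun_prop
    have hmeasF : Measurable fun x : V => ∫⁻ y in F, k ‖x - y‖ := hmeas.lintegral_prod_right'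
    rw [interaction, ← lintegral_add_left hmeasF, ← setLIntegral_const]
    congr 1 with x
    rw [lintegral_add_compl _ hF]
    exact lintegral_sub_left_eq_self (μ := (volume : Measure V)) (fun y => k ‖y‖) x
  have hI := interaction_le_ball hk hanti hκ hE hvol.le
  have hB := htotal (ball 0 a) measurableSet_ball
  have hball : volume (ball (0 : V) a) ≠ ∞ := measure_ball_lt_top.ne
  have hfin : interaction k (ball (0 : V) a) ≠ ∞ := by
    refine ne_top_of_le_ne_top (ENNReal.mul_ne_top hκ hball) ?_
    exact le_self_add.trans hB.le
  rw [← hvol, ← htotal E hE] at hB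
  refine (ENNReal.add_le_add_iff_left hfin).1 ?_
  rw [hB]
  gcongr

end Polarization

/-- The regularized kernel `(r + ε)^(-p)` is integrable. -/
lemma lintegral_add_norm_rpow_ne_top {n : ℕ} {p ε : ℝ} (hp : n < p) (hε : 0 < ε) (hε1 : ε ≤ 1) :
    ∫⁻ y : EuclideanSpace ℝ (Fin n), ENNReal.ofReal ((‖y‖ + ε) ^ (-p)) ≠ ∞ := by
  have h := finite_integral_one_add_norm (E := EuclideanSpace ℝ (Fin n)) (μ := volume) (r := p)
    (by simpa using hp)
  have hp0 : 0 ≤ p := (Nat.cast_nonneg n).trans hp.le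
  refine ne_top_of_le_ne_top (ENNReal.mul_ne_top ENNReal.ofReal_ne_top h.ne :
    ENNReal.ofReal (ε ^ (-p)) * _ ≠ ∞) ?_
  rw [← lintegral_const_mul' _ _ ENNReal.ofReal_ne_top]
  refine lintegral_mono fun y => ?_
  rw [← ENNReal.ofReal_mul (by positivity), ← Real.mul_rpow hε.le (by positivity)]
  refine ENNReal.ofReal_le_ofReal (Real.rpow_le_rpow_of_nonpos (by positivity) ?_ (by linarith))
  nlinarith [norm_nonneg y]

lemma fracPerimeter_ball_le {n : ℕ} (hn : n ≠ 0) {α : ℝ} (hα : 0 < α)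
    {E : Set (EuclideanSpace ℝ (Fin n))} (hE : MeasurableSet E) {a : ℝ}
    (hvol : volume E = volume (ball (0 : EuclideanSpace ℝ (Fin n)) a)) :
    fracPerimeter n α (ball 0 a) ≤ fracPerimeter n α E := by
  have : NeZero n := ⟨hn⟩
  set p : ℝ := n + α
  have hp : (n : ℝ) < p := lt_add_of_pos_right _ hα
  have hp0 : 0 < p := (Nat.cast_nonneg n).trans_lt hp
  set ε : ℕ → ℝ := fun i => 1 / ((i : ℝ) + 1)
  have hε : ∀ i, 0 < ε i := fun i => Nat.one_div_pos_of_nat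
  have hε1 : ∀ i, ε i ≤ 1 := fun i => by
    simpa [ε] using Nat.one_div_le_one_div (α := ℝ) (Nat.zero_le i)
  have hεlim : Filter.Tendsto ε Filter.atTop (nhds 0) := tendsto_one_div_add_atTop_nhds_zero_nat
  set k : ℕ → ℝ → ℝ≥0∞ := fun i r => ENNReal.ofReal ((r + ε i) ^ (-p))
  have hk : ∀ i, Measurable (k i) := fun i => by fun_prop
  have hanti : ∀ i, AntitoneOn (k i) (Ici 0) := fun i r (hr : 0 ≤ r) s _ hrs =>
    ENNReal.ofReal_le_ofReal (Real.rpow_le_rpow_of_nonpos (by linarith [hε i]) (by linarith)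
      (by linarith))
  have hball : ∀ i, ∫⁻ x in ball (0 : EuclideanSpace ℝ (Fin n)) a, ∫⁻ y in (ball 0 a)ᶜ,
      k i ‖x - y‖ ≤ fracPerimeter n α E := by
    intro i
    refine (lintegral_ball_compl_le (hk i) (hanti i)
      (lintegral_add_norm_rpow_ne_top hp (hε i) (hε1 i)) hE hvol).trans ?_
    refine setLIntegral_mono' hE fun x hx => setLIntegral_mono' hE.compl fun y hy => ?_
    have hxy : 0 < ‖x - y‖ := norm_pos_iff.2 (sub_ne_zero.2 fun h => hy (h ▸ hx))
    exact ENNReal.ofReal_le_ofReal (Real.rpow_le_rpow_of_nonpos hxy (by linarith [hε i])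
      (by linarith))
  have hmeas' : ∀ i (x : EuclideanSpace ℝ (Fin n)), Measurable fun y => k i ‖x - y‖ :=
    fun i x => (hk i).comp (by fun_prop)
  have hmeas : ∀ i, Measurable fun x : EuclideanSpace ℝ (Fin n) =>
      ∫⁻ y in (ball 0 a)ᶜ, k i ‖x - y‖ := fun i =>
    Measurable.lintegral_prod_right' (f := fun q : EuclideanSpace ℝ (Fin n) ×
      EuclideanSpace ℝ (Fin n) => k i ‖q.1 - q.2‖) ((hk i).comp (by fun_prop))
  calc fracPerimeter n α (ball 0 a)
      ≤ ∫⁻ x in ball (0 : EuclideanSpace ℝ (Fin n)) a, ∫⁻ y in (ball 0 a)ᶜ,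
          Filter.liminf (fun i => k i ‖x - y‖) Filter.atTop := by
        refine setLIntegral_mono' measurableSet_ball fun x hx =>
          setLIntegral_mono' measurableSet_ball.compl fun y hy => ?_
        have hxy : 0 < ‖x - y‖ := norm_pos_iff.2 (sub_ne_zero.2 fun h => hy (h ▸ hx))
        refine (Filter.Tendsto.liminf_eq ?_).ge
        refine ENNReal.tendsto_ofReal ?_
        have h1 : Filter.Tendsto (fun i => ‖x - y‖ + ε i) Filter.atTop (nhds ‖x - y‖) := by
          simpa using hεlim.const_add ‖x - y‖
        exact h1.rpow_const (Or.inl hxy.ne')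
    _ ≤ ∫⁻ x in ball (0 : EuclideanSpace ℝ (Fin n)) a,
          Filter.liminf (fun i => ∫⁻ y in (ball 0 a)ᶜ, k i ‖x - y‖) Filter.atTop :=
        lintegral_mono fun x => lintegral_liminf_le fun i => hmeas' i x
    _ ≤ Filter.liminf (fun i => ∫⁻ x in ball (0 : EuclideanSpace ℝ (Fin n)) a,
          ∫⁻ y in (ball 0 a)ᶜ, k i ‖x - y‖) Filter.atTop :=
        lintegral_liminf_le hmeas
    _ ≤ fracPerimeter n α E :=
        (Filter.liminf_le_liminf (.of_forall hball)).trans_eq (Filter.liminf_const _)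

/-- The bathtub principle for a nondecreasing radial potential. -/
lemma lintegral_ball_le_of_monotoneOn {V : Type*} [NormedAddCommGroup V] [MeasurableSpace V]
    [OpensMeasurableSpace V] {μ : Measure V} {h : ℝ → ℝ} (hmono : MonotoneOn h (Ici 0)) {a : ℝ}
    (ha : 0 ≤ a) {E : Set V} (hE : MeasurableSet E) (hvol : μ E = μ (ball 0 a))
    (hfin : μ E ≠ ∞) :
    ∫⁻ x in ball 0 a, ENNReal.ofReal (h ‖x‖) ∂μ ≤ ∫⁻ x in E, ENNReal.ofReal (h ‖x‖) ∂μ := by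
  have hB : MeasurableSet (ball (0 : V) a) := measurableSet_ball
  have hdiff : μ (ball 0 a \ E) = μ (E \ ball 0 a) := by
    have h1 := measure_inter_add_sdiff (μ := μ) E hB
    have h2 := measure_inter_add_sdiff (μ := μ) (ball (0 : V) a) hE
    rw [← hvol, ← h1, inter_comm] at h2
    exact (ENNReal.add_right_inj
      (ne_top_of_le_ne_top hfin (measure_mono inter_subset_left))).1 h2
  rw [← lintegral_inter_add_sdiff _ (ball 0 a) hE, ← lintegral_inter_add_sdiff _ E hB, inter_comm]
  gcongr 1
  calc ∫⁻ x in ball 0 a \ E, ENNReal.ofReal (h ‖x‖) ∂μ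
      ≤ ∫⁻ _ in ball 0 a \ E, ENNReal.ofReal (h a) ∂μ :=
        setLIntegral_mono' (hB.diff hE) fun x hx => ENNReal.ofReal_le_ofReal
          (hmono (norm_nonneg x) ha (mem_ball_zero_iff.1 hx.1).le)
    _ = ∫⁻ _ in E \ ball 0 a, ENNReal.ofReal (h a) ∂μ := by
        rw [setLIntegral_const, setLIntegral_const, hdiff]
    _ ≤ ∫⁻ x in E \ ball 0 a, ENNReal.ofReal (h ‖x‖) ∂μ :=
        setLIntegral_mono' (hE.diff hB) fun x hx => ENNReal.ofReal_le_ofReal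
          (hmono ha (norm_nonneg x) (by simpa using hx.2))

/-- The centered ball minimizes the nonlocal free energy with a nondecreasing radial
potential among sets of its volume. -/
theorem stmt_3 (n : ℕ) (hn : 2 ≤ n) (α : ℝ) (hα : α ∈ Set.Ioo (0 : ℝ) 1)
    (h : ℝ → ℝ) (hmono : MonotoneOn h (Set.Ici 0)) (hpos : ∀ t : ℝ, 0 ≤ t → 0 ≤ h t)
    (a : ℝ) (ha : 0 < a)
    (E : Set (EuclideanSpace ℝ (Fin n))) (hE : MeasurableSet E)
    (hvol : volume E = volume (ball (0 : EuclideanSpace ℝ (Fin n)) a)) :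
    freeEnergy n α (fun x => h ‖x‖) (ball (0 : EuclideanSpace ℝ (Fin n)) a)
      ≤ freeEnergy n α (fun x => h ‖x‖) E := by
  exact add_le_add (fracPerimeter_ball_le (by omega) hα.1 hE hvol)
    (lintegral_ball_le_of_monotoneOn hmono ha.le hE hvol (hvol.trans_lt measure_ball_lt_top).ne)
end

section
/- Let n ≥ 1 and let h : [0,∞) → [0,∞) be strictly increasing with h(0) = 0; set g(x) = h(|x|). Then for every a > 0 and every z ∈ ℝⁿ with z ≠ 0, one has ∫_{B_a + z} g(x) dx > ∫_{B_a} g(x) dx. Consequently, for any α ∈ (0,1), 𝓔(B_a + z) > 𝓔(B_a) for all z ≠ 0; i.e., no nontrivial translate of the centered ball attains the same nonlocal free energy. -/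
open MeasureTheory Metric Set
open scoped ENNReal

/-- The fractional perimeter is invariant under translations. -/
theorem fracPerimeter_image_add_right (n : ℕ) (α : ℝ) (z : EuclideanSpace ℝ (Fin n))
    (E : Set (EuclideanSpace ℝ (Fin n))) :
    fracPerimeter n α ((fun y => y + z) '' E) = fracPerimeter n α E := by
  have hp := measurePreserving_add_right (volume : Measure (EuclideanSpace ℝ (Fin n))) z
  have he : MeasurableEmbedding (fun y : EuclideanSpace ℝ (Fin n) => y + z) :=
    measurableEmbedding_addRight z
  have hc : ((fun y => y + z) '' E)ᶜ = (fun y => y + z) '' Eᶜ :=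
    (image_compl_eq (AddGroup.addRight_bijective z)).symm
  unfold fracPerimeter
  rw [hc, ← hp.setLIntegral_comp_emb he]
  refine lintegral_congr fun x => ?_
  rw [← hp.setLIntegral_comp_emb he]
  simp only [add_sub_add_right_eq_sub]

/-- The fractional perimeter as an integral over displacements. -/
theorem fracPerimeter_eq_lintegral_displacement (n : ℕ) (α : ℝ)
    {E : Set (EuclideanSpace ℝ (Fin n))} (hE : MeasurableSet E) :
    fracPerimeter n α E =
      ∫⁻ w : EuclideanSpace ℝ (Fin n), volume {x | x ∈ E ∧ x - w ∉ E} *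
        ENNReal.ofReal (‖w‖ ^ (-((n : ℝ) + α))) := by
  set F : EuclideanSpace ℝ (Fin n) → ℝ≥0∞ :=
    fun w => ENNReal.ofReal (‖w‖ ^ (-((n : ℝ) + α))) with hF
  have hFm : Measurable F := by
    rw [hF]; fun_prop
  have hS : MeasurableSet {p : EuclideanSpace ℝ (Fin n) × EuclideanSpace ℝ (Fin n) |
      p.1 ∈ E ∧ p.1 - p.2 ∉ E} :=
    (measurable_fst hE).inter ((measurable_fst.sub measurable_snd) hE).compl
  have key : ∀ x w : EuclideanSpace ℝ (Fin n),
      E.indicator (fun x => Eᶜ.indicator (fun y => F (x - y)) (x - w)) x =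
        {p : EuclideanSpace ℝ (Fin n) × EuclideanSpace ℝ (Fin n) |
          p.1 ∈ E ∧ p.1 - p.2 ∉ E}.indicator (fun p => F p.2) (x, w) := by
    intro x w
    by_cases h₁ : x ∈ E <;> by_cases h₂ : x - w ∈ E <;> simp [indicator, h₁, h₂]
  calc fracPerimeter n α E
      = ∫⁻ x, E.indicator (fun x => ∫⁻ y, Eᶜ.indicator (fun y => F (x - y)) y) x := by
        rw [lintegral_indicator hE]
        refine lintegral_congr fun x => ?_
        rw [lintegral_indicator hE.compl]
    _ = ∫⁻ x, ∫⁻ w, {p : EuclideanSpace ℝ (Fin n) × EuclideanSpace ℝ (Fin n) |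
          p.1 ∈ E ∧ p.1 - p.2 ∉ E}.indicator (fun p => F p.2) (x, w) := by
        refine lintegral_congr fun x => ?_
        simp only [← key]
        by_cases hx : x ∈ E
        · simp only [indicator_of_mem hx]
          exact (lintegral_sub_left_eq_self (Eᶜ.indicator fun y => F (x - y)) x).symm
        · simp [indicator_of_notMem hx]
    _ = ∫⁻ w, ∫⁻ x, {p : EuclideanSpace ℝ (Fin n) × EuclideanSpace ℝ (Fin n) |
          p.1 ∈ E ∧ p.1 - p.2 ∉ E}.indicator (fun p => F p.2) (x, w) :=
        lintegral_lintegral_swap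
          (((hFm.comp measurable_snd).indicator hS).aemeasurable)
    _ = ∫⁻ w, volume {x | x ∈ E ∧ x - w ∉ E} * F w := by
        refine lintegral_congr fun w => ?_
        have hw : MeasurableSet {x | x ∈ E ∧ x - w ∉ E} :=
          hE.inter ((measurable_id.sub_const w) hE).compl
        rw [mul_comm, ← lintegral_indicator_const hw]
        rfl

/-- The part of a ball that a translation by `w` moves out of the ball has volume at most a
constant times `min 1 ‖w‖`. -/
theorem exists_volume_ball_sub_notMem_le (n : ℕ) {a : ℝ} (ha : 0 < a) :
    ∃ K : ℝ, ∀ w : EuclideanSpace ℝ (Fin n),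
      volume {x | x ∈ ball (0 : EuclideanSpace ℝ (Fin n)) a ∧ x - w ∉ ball 0 a} ≤
        ENNReal.ofReal (K * min 1 ‖w‖) := by
  set E := EuclideanSpace ℝ (Fin n)
  obtain ⟨c, hc0, hc⟩ : ∃ c : ℝ, 0 ≤ c ∧ volume (ball (0 : E) 1) = ENNReal.ofReal c :=
    ⟨_, ENNReal.toReal_nonneg, (ENNReal.ofReal_toReal measure_ball_lt_top.ne).symm⟩
  have hball : ∀ r : ℝ, 0 < r → volume (ball (0 : E) r) = ENNReal.ofReal (r ^ n * c) := by
    intro r hr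
    rw [Measure.addHaar_ball_of_pos _ _ hr, hc, ← ENNReal.ofReal_mul (by positivity)]
    simp [E]
  have hmain : ∀ w : E, ‖w‖ < a →
      volume {x | x ∈ ball (0 : E) a ∧ x - w ∉ ball 0 a} ≤
        ENNReal.ofReal (a ^ n * c * (n * (‖w‖ / a))) := by
    intro w hwa
    have hsub : {x | x ∈ ball (0 : E) a ∧ x - w ∉ ball 0 a} ⊆
        ball (0 : E) a \ ball 0 (a - ‖w‖) := by
      rintro x ⟨hx, hxw⟩
      refine ⟨hx, fun hx' => hxw ?_⟩
      rw [mem_ball_zero_iff] at hx' ⊢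
      linarith [norm_sub_le x w]
    refine (measure_mono hsub).trans ?_
    rw [measure_sdiff (ball_subset_ball (by linarith [norm_nonneg w]))
      measurableSet_ball.nullMeasurableSet measure_ball_lt_top.ne, hball _ ha,
      hball _ (by linarith), ← ENNReal.ofReal_sub]
    · apply ENNReal.ofReal_le_ofReal
      have hbern := one_add_mul_le_pow (a := -(‖w‖ / a))
        (by linarith [(div_lt_one ha).2 hwa]) n
      have hpow : (a - ‖w‖) ^ n = a ^ n * (1 + -(‖w‖ / a)) ^ n := by
        rw [← mul_pow]
        congr 1
        field_simp
        ring
      rw [hpow]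
      have hn : 0 ≤ a ^ n * c := by positivity
      nlinarith [mul_le_mul_of_nonneg_left hbern hn]
    · have : 0 < a - ‖w‖ := by linarith
      positivity
  refine ⟨a ^ n * c * (1 + n / a + 1 / a), fun w => ?_⟩
  have hle : volume {x | x ∈ ball (0 : E) a ∧ x - w ∉ ball 0 a} ≤ ENNReal.ofReal (a ^ n * c) :=
    (measure_mono fun x hx => hx.1).trans (hball a ha).le
  have hA : 0 ≤ a ^ n * c := by positivity
  have hna : 0 ≤ (n : ℝ) / a := by positivity
  have ha' : 0 ≤ 1 / a := by positivity
  rcases le_total 1 ‖w‖ with h1 | h1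
  · refine hle.trans (ENNReal.ofReal_le_ofReal ?_)
    rw [min_eq_left h1, mul_one]
    nlinarith [mul_nonneg hA hna, mul_nonneg hA ha']
  rw [min_eq_right h1]
  rcases lt_or_ge ‖w‖ a with h2 | h2
  · refine (hmain w h2).trans (ENNReal.ofReal_le_ofReal ?_)
    have : (n : ℝ) * (‖w‖ / a) = n / a * ‖w‖ := by ring
    have h3 : (n : ℝ) / a * ‖w‖ ≤ (1 + n / a + 1 / a) * ‖w‖ := by gcongr; linarith
    rw [this, mul_assoc (a ^ n * c) (_ + _)]
    exact mul_le_mul_of_nonneg_left h3 hA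
  · refine hle.trans (ENNReal.ofReal_le_ofReal ?_)
    have h3 : 1 ≤ 1 / a * ‖w‖ := by
      rw [one_div_mul_eq_div]; exact (one_le_div ha).2 h2
    have h4 : 0 ≤ (1 + n / a) * ‖w‖ := by positivity
    rw [mul_assoc]
    exact le_mul_of_one_le_right hA (by nlinarith)

/-- The truncated kernel `|w|^{-(n+α)} min(1, |w|)` is integrable. -/
theorem integrable_norm_rpow_mul_min (n : ℕ) (hn : 1 ≤ n) {α : ℝ} (hα : α ∈ Ioo (0 : ℝ) 1) :
    Integrable fun w : EuclideanSpace ℝ (Fin n) =>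
      min 1 ‖w‖ * ‖w‖ ^ (-((n : ℝ) + α)) := by
  have : Nonempty (Fin n) := ⟨⟨0, hn⟩⟩
  rw [integrable_fun_norm_addHaar (volume : Measure (EuclideanSpace ℝ (Fin n)))
    (f := fun r => min 1 r * r ^ (-((n : ℝ) + α))), finrank_euclideanSpace_fin,
    ← Ioc_union_Ioi_eq_Ioi zero_le_one, integrableOn_union]
  have hpow : ∀ r : ℝ, 0 < r → r ^ (n - 1) * r ^ (-((n : ℝ) + α)) = r ^ (-1 - α) := by
    intro r hr
    rw [← Real.rpow_natCast, ← Real.rpow_add hr, Nat.cast_sub hn]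
    congr 1
    push_cast
    ring
  constructor
  · have hint : IntegrableOn (fun r : ℝ => r ^ (-α)) (Ioc 0 1) :=
      (intervalIntegrable_iff_integrableOn_Ioc_of_le zero_le_one).1
        (intervalIntegral.intervalIntegrable_rpow' (by linarith [hα.2]))
    refine hint.congr_fun (fun r hr => ?_) measurableSet_Ioc
    have h1 : r * r ^ (-1 - α) = r ^ (-α) := by
      rw [← Real.rpow_one_add' hr.1.le (by linarith [hα.1, hα.2] : (1 : ℝ) + (-1 - α) ≠ 0)]
      congr 1
      ring
    simp only [smul_eq_mul, min_eq_right hr.2]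
    rw [mul_left_comm, hpow r hr.1, h1]
  · have hint : IntegrableOn (fun r : ℝ => r ^ (-1 - α)) (Ioi 1) :=
      integrableOn_Ioi_rpow_of_lt (by linarith [hα.1]) one_pos
    refine hint.congr_fun (fun r hr => ?_) measurableSet_Ioi
    rw [mem_Ioi] at hr
    simp only [smul_eq_mul, min_eq_left hr.le, one_mul]
    exact (hpow r (one_pos.trans hr)).symm

/-- Balls have finite fractional perimeter. -/
theorem fracPerimeter_ball_ne_top (n : ℕ) (hn : 1 ≤ n) {α : ℝ} (hα : α ∈ Ioo (0 : ℝ) 1)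
    {a : ℝ} (ha : 0 < a) :
    fracPerimeter n α (ball (0 : EuclideanSpace ℝ (Fin n)) a) ≠ ∞ := by
  obtain ⟨K, hK⟩ := exists_volume_ball_sub_notMem_le n ha
  rw [fracPerimeter_eq_lintegral_displacement n α measurableSet_ball]
  refine ne_top_of_le_ne_top
    ((integrable_norm_rpow_mul_min n hn hα).const_mul K).lintegral_lt_top.ne
    (lintegral_mono fun w => ?_)
  refine (mul_le_mul_left (hK w) _).trans ?_
  rw [← ENNReal.ofReal_mul' (by positivity), mul_assoc]

/-- If two finite-measure sets have equal measure, and `f` is below a constant on `A \ B` and at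
least that constant on `B \ A`, then the integral over `A` is smaller than that over `B`. -/
theorem setLIntegral_lt_of_lt_const_of_const_le {X : Type*} [MeasurableSpace X] {μ : Measure X}
    {A B : Set X} (hA : MeasurableSet A) (hB : MeasurableSet B) (hAB : μ A = μ B)
    (hfin : μ B ≠ ∞) (hne : μ (A \ B) ≠ 0) {f : X → ℝ≥0∞} {c : ℝ≥0∞} (hc : c ≠ ∞)
    (hlt : ∀ x ∈ A \ B, f x < c) (hle : ∀ x ∈ B \ A, c ≤ f x)
    (hfi : ∫⁻ x in A ∩ B, f x ∂μ ≠ ∞) :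
    ∫⁻ x in A, f x ∂μ < ∫⁻ x in B, f x ∂μ := by
  have hdiff : μ (A \ B) = μ (B \ A) := by
    have h1 := measure_sdiff_add_inter (μ := μ) A hB
    have h2 := measure_sdiff_add_inter (μ := μ) B hA
    rw [inter_comm B A, ← hAB, ← h1] at h2
    exact (WithTop.add_right_cancel
      (measure_ne_top_of_subset inter_subset_right hfin) h2).symm
  have hfinAB : μ (A \ B) ≠ ∞ := measure_ne_top_of_subset sdiff_subset (hAB ▸ hfin)
  have hfi' : ∫⁻ x in A \ B, f x ∂μ ≠ ∞ := by
    refine ne_top_of_le_ne_top (ENNReal.mul_ne_top hc hfinAB) ?_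
    rw [← setLIntegral_const]
    exact setLIntegral_mono' (hA.diff hB) fun x hx => (hlt x hx).le
  have key : ∫⁻ x in A \ B, f x ∂μ < ∫⁻ x in B \ A, f x ∂μ := calc
    ∫⁻ x in A \ B, f x ∂μ < ∫⁻ _ in A \ B, c ∂μ :=
      setLIntegral_strict_mono (hA.diff hB) hne measurable_const hfi'
        (Filter.Eventually.of_forall hlt)
    _ = ∫⁻ _ in B \ A, c ∂μ := by rw [setLIntegral_const, setLIntegral_const, hdiff]
    _ ≤ ∫⁻ x in B \ A, f x ∂μ := setLIntegral_mono' (hB.diff hA) hle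
  rw [← lintegral_inter_add_sdiff f A hB, ← lintegral_inter_add_sdiff f B hA, inter_comm B A]
  exact ENNReal.add_lt_add_left hfi key

/-- A nontrivial translate of a centered ball misses a set of positive volume of the ball. -/
theorem volume_ball_zero_sdiff_ball_ne_zero {E : Type*} [NormedAddCommGroup E] [NormedSpace ℝ E]
    [MeasurableSpace E] (μ : Measure E) [μ.IsOpenPosMeasure] {a : ℝ} (ha : 0 < a) {z : E}
    (hz : z ≠ 0) : μ (ball 0 a \ ball z a) ≠ 0 := by
  have hz' : 0 < ‖z‖ := norm_pos_iff.2 hz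
  obtain ⟨t, ht0, hta, htz⟩ : ∃ t : ℝ, 0 ≤ t ∧ t < a ∧ a < t + ‖z‖ := by
    obtain ⟨t, ht, hta⟩ := exists_between (max_lt ha (by linarith : a - ‖z‖ < a))
    exact ⟨t, (le_max_left _ _).trans ht.le, hta, by linarith [(le_max_right _ _).trans_lt ht]⟩
  have hopen : IsOpen (ball 0 a \ closedBall z a) := isOpen_ball.sdiff isClosed_closedBall
  have hne : (ball 0 a \ closedBall z a).Nonempty := by
    refine ⟨-(t / ‖z‖) • z, ?_, ?_⟩
    · rw [mem_ball_zero_iff, norm_smul, norm_neg, norm_div, norm_norm, div_mul_cancel₀ _ hz'.ne',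
        Real.norm_of_nonneg ht0]
      exact hta
    · have h1 : -(t / ‖z‖) • z - z = -((t / ‖z‖ + 1) • z) := by module
      have h2 : 0 ≤ t / ‖z‖ + 1 := by positivity
      rw [mem_closedBall, dist_eq_norm, h1, norm_neg, norm_smul, Real.norm_of_nonneg h2, add_mul,
        div_mul_cancel₀ _ hz'.ne', one_mul, not_le]
      exact htz
  exact ((hopen.measure_pos μ hne).trans_le
    (measure_mono (sdiff_subset_sdiff_right ball_subset_closedBall))).ne'

/-- A nontrivial translate of the centered ball strictly increases the potential term,
hence the nonlocal free energy, for a strictly increasing radial potential. -/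
theorem stmt_4 (n : ℕ) (hn : 1 ≤ n)
    (h : ℝ → ℝ) (hmono : StrictMonoOn h (Set.Ici 0)) (h0 : h 0 = 0)
    (hpos : ∀ t : ℝ, 0 ≤ t → 0 ≤ h t)
    (a : ℝ) (ha : 0 < a) (z : EuclideanSpace ℝ (Fin n)) (hz : z ≠ 0) :
    (∫⁻ x in (fun y => y + z) '' ball (0 : EuclideanSpace ℝ (Fin n)) a,
        ENNReal.ofReal (h ‖x‖))
      > ∫⁻ x in ball (0 : EuclideanSpace ℝ (Fin n)) a, ENNReal.ofReal (h ‖x‖) ∧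
    ∀ α : ℝ, α ∈ Set.Ioo (0 : ℝ) 1 →
      freeEnergy n α (fun x => h ‖x‖) ((fun y => y + z) '' ball (0 : EuclideanSpace ℝ (Fin n)) a)
        > freeEnergy n α (fun x => h ‖x‖) (ball (0 : EuclideanSpace ℝ (Fin n)) a) := by
  set A := ball (0 : EuclideanSpace ℝ (Fin n)) a with hA
  have himg : (fun y => y + z) '' A = ball z a := by
    rw [image_add_right, hA]
    ext x
    simp [dist_eq_norm, sub_eq_add_neg]
  have hha : 0 < h a := h0 ▸ hmono self_mem_Ici ha.le ha
  have hlt : ∀ x ∈ A, ENNReal.ofReal (h ‖x‖) < ENNReal.ofReal (h a) := fun x hx =>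
    (ENNReal.ofReal_lt_ofReal_iff hha).2
      (hmono (norm_nonneg x) ha.le (mem_ball_zero_iff.1 hx))
  have hfinA : ∫⁻ x in A, ENNReal.ofReal (h ‖x‖) ≠ ∞ := by
    refine ne_top_of_le_ne_top
      (ENNReal.mul_ne_top (ENNReal.ofReal_ne_top (r := h a))
        (measure_ball_lt_top : volume A < ∞).ne) ?_
    rw [← setLIntegral_const]
    exact setLIntegral_mono' measurableSet_ball fun x hx => (hlt x hx).le
  have hpot : ∫⁻ x in A, ENNReal.ofReal (h ‖x‖) <
      ∫⁻ x in (fun y => y + z) '' A, ENNReal.ofReal (h ‖x‖) := by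
    rw [himg]
    refine setLIntegral_lt_of_lt_const_of_const_le measurableSet_ball measurableSet_ball
      (Measure.addHaar_ball_center volume z a).symm measure_ball_lt_top.ne
      (volume_ball_zero_sdiff_ball_ne_zero volume ha hz) (ENNReal.ofReal_ne_top (r := h a))
      (fun x hx => hlt x hx.1) (fun x hx => ?_)
      (ne_top_of_le_ne_top hfinA (lintegral_mono_set inter_subset_left))
    have hx : a ≤ ‖x‖ := by simpa [hA] using hx.2
    exact ENNReal.ofReal_le_ofReal (hmono.monotoneOn ha.le (norm_nonneg x) hx)
  refine ⟨hpot, fun α hα => ?_⟩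
  unfold freeEnergy
  rw [fracPerimeter_image_add_right]
  exact ENNReal.add_lt_add_left (fracPerimeter_ball_ne_top n hn hα ha) hpot
end
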